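/- Let X be a directed space. The following are equivalent: (1) X is core compact, i.e., the lattice O(X) of open subsets of X is a continuous lattice; (2) for every directed space Y, every directed-open subset of the product space X × Y is open, i.e., X × Y (with the product topology) is a directed space; (3) the product space Σ O(X) × X, where Σ O(X) is the complete lattice O(X) endowed with the Scott topology, is a directed space. -/

import Mathlib

open Set TopologicalSpace

universe u

variable {X : Type*}

/-- Specialization order: `x ⊑ y` iff `x ∈ cl {y}`. -/
def specLE (t : TopologicalSpace X) (x y : X) : Prop := x ∈ @closure X t {y}

/-- `↑A` with respect to the specialization order. -/
def upSet (t : TopologicalSpace X) (A : Set X) : Set X := {z | ∃ a ∈ A, specLE t a z}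

/-- `↓A` with respect to the specialization order. -/
def downSet (t : TopologicalSpace X) (A : Set X) : Set X := {z | ∃ a ∈ A, specLE t z a}

/-- A directed subset with respect to the specialization order. -/
def DirSet (t : TopologicalSpace X) (D : Set X) : Prop :=
  D.Nonempty ∧ ∀ a ∈ D, ∀ b ∈ D, ∃ c ∈ D, specLE t a c ∧ specLE t b c

/-- `D → x`: every open set containing `x` meets `D`. -/
def DConv (t : TopologicalSpace X) (D : Set X) (x : X) : Prop :=
  ∀ U : Set X, t.IsOpen U → x ∈ U → (D ∩ U).Nonempty

/-- Directed-open subset. -/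
def DirOpen (t : TopologicalSpace X) (U : Set X) : Prop :=
  ∀ D : Set X, DirSet t D → ∀ x ∈ U, DConv t D x → (D ∩ U).Nonempty

/-- A directed space: every directed-open set is open. -/
def DirSpace (t : TopologicalSpace X) : Prop :=
  ∀ U : Set X, DirOpen t U → t.IsOpen U

/-- `x ≪_d y`. -/
def dWay (t : TopologicalSpace X) (x y : X) : Prop :=
  ∀ D : Set X, DirSet t D → DConv t D y → ∃ d ∈ D, specLE t x d

/-- c-space. -/
def CSpace (t : TopologicalSpace X) : Prop :=
  ∀ (x : X) (U : Set X), t.IsOpen U → x ∈ U → ∃ y ∈ U, x ∈ @interior X t (upSet t {y})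

/-- b-space. -/
def BSpace (t : TopologicalSpace X) : Prop :=
  ∀ (x : X) (U : Set X), t.IsOpen U → x ∈ U →
    ∃ y ∈ U, t.IsOpen (upSet t {y}) ∧ x ∈ upSet t {y} ∧ upSet t {y} ⊆ U

/-- locally hypercompact space. -/
def LocallyHypercompact (t : TopologicalSpace X) : Prop :=
  ∀ (U : Set X), t.IsOpen U → ∀ x ∈ U, ∃ F : Set X, F.Finite ∧
    x ∈ @interior X t (upSet t F) ∧ upSet t F ⊆ U

/-- `s` is the supremum of `A` with respect to the specialization order. -/
def IsSupOf (t : TopologicalSpace X) (A : Set X) (s : X) : Prop :=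
  (∀ a ∈ A, specLE t a s) ∧ ∀ y : X, (∀ a ∈ A, specLE t a y) → specLE t s y

/-- Topological ideal: a directed lower set possessing a supremum to which it converges. -/
def TopIdeal (t : TopologicalSpace X) (A : Set X) : Prop :=
  DirSet t A ∧ downSet t A = A ∧ ∃ s : X, IsSupOf t A s ∧ DConv t A s

/-- The set `I_T(X)` of topological ideals. -/
abbrev IT (t : TopologicalSpace X) := {A : Set X // TopIdeal t A}

/-- The family `Ω(I_T(X))`. -/
def OmegaOpen (t : TopologicalSpace X) (U : Set (IT t)) : Prop :=
  ∀ A : IT t, A ∈ U ↔ ∃ B ∈ U, (∃ x : X, B.1 = downSet t {x}) ∧ B.1 ⊆ A.1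

/-- Way-below relation in a complete lattice. -/
def wayBelow {L : Type*} [CompleteLattice L] (a b : L) : Prop :=
  ∀ D : Set L, D.Nonempty → DirectedOn (· ≤ ·) D → b ≤ sSup D → ∃ d ∈ D, a ≤ d

/-- Continuous (complete) lattice. -/
def ContinuousLattice (L : Type*) [CompleteLattice L] : Prop :=
  ∀ x : L, {a : L | wayBelow a x}.Nonempty ∧ DirectedOn (· ≤ ·) {a : L | wayBelow a x} ∧
    sSup {a : L | wayBelow a x} = x

/-- Completely distributive complete lattice. -/
def CompletelyDistrib (L : Type u) [CompleteLattice L] : Prop :=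
  ∀ (ι : Type u) (κ : ι → Type u) (f : (i : ι) → κ i → L),
    (⨅ i, ⨆ j, f i j) = ⨆ g : (i : ι) → κ i, ⨅ i, f i (g i)

/-- `↑F` in a preordered set. -/
def upOf {L : Type*} [Preorder L] (F : Set L) : Set L := {z | ∃ f ∈ F, f ≤ z}

/-- `F ≪ x` for a set `F` in a complete lattice. -/
def finWay {L : Type*} [CompleteLattice L] (F : Set L) (x : L) : Prop :=
  ∀ D : Set L, D.Nonempty → DirectedOn (· ≤ ·) D → x ≤ sSup D → ∃ d ∈ D, ∃ f ∈ F, f ≤ d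

/-- Quasicontinuous complete lattice. -/
def QuasicontinuousLattice (L : Type*) [CompleteLattice L] : Prop :=
  ∀ x : L,
    (∀ F G : Set L, F.Finite → finWay F x → G.Finite → finWay G x →
      ∃ H : Set L, H.Finite ∧ finWay H x ∧ upOf H ⊆ upOf F ∧ upOf H ⊆ upOf G) ∧
    Set.Ici x = ⋂₀ {S : Set L | ∃ F : Set L, F.Finite ∧ finWay F x ∧ S = upOf F}

/-- Algebraic complete lattice: every element is the sup of the compact elements below it. -/
def AlgebraicLattice (L : Type*) [CompleteLattice L] : Prop :=
  ∀ x : L, sSup {k : L | wayBelow k k ∧ k ≤ x} = x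

/-- Scott-open subset of a preordered set. -/
def ScottOpen {L : Type*} [Preorder L] (U : Set L) : Prop :=
  IsUpperSet U ∧ ∀ D : Set L, D.Nonempty → DirectedOn (· ≤ ·) D →
    ∀ s : L, IsLUB D s → s ∈ U → (D ∩ U).Nonempty

/-- The Scott topology. -/
def scottSp (L : Type*) [Preorder L] : TopologicalSpace L :=
  TopologicalSpace.generateFrom {U : Set L | ScottOpen U}

/-- The upper topology. -/
def upperSp (L : Type*) [Preorder L] : TopologicalSpace L :=
  TopologicalSpace.generateFrom {S : Set L | ∃ a : L, S = (Set.Iic a)ᶜ}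

theorem specLE_iff {X : Type*} (t : TopologicalSpace X) (x y : X) :
    specLE t x y ↔ ∀ U : Set X, t.IsOpen U → x ∈ U → y ∈ U := by
  unfold specLE
  rw [mem_closure_iff]
  constructor
  · intro h U hU hx
    obtain ⟨z, hz, hz'⟩ := h U hU hx
    rw [mem_singleton_iff] at hz'
    exact hz' ▸ hz
  · intro h U hU hx
    exact ⟨y, h U hU hx, rfl⟩

theorem specLE_refl' {X : Type*} (t : TopologicalSpace X) (x : X) : specLE t x x :=
  (specLE_iff t x x).2 fun _ _ h => h

theorem specLE_prod {X Y : Type*} (t : TopologicalSpace X) (s : TopologicalSpace Y)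
    (p q : X × Y) :
    specLE (@instTopologicalSpaceProd X Y t s) p q ↔ specLE t p.1 q.1 ∧ specLE s p.2 q.2 := by
  obtain ⟨a, b⟩ := p
  obtain ⟨c, d⟩ := q
  have : ({(c, d)} : Set (X × Y)) = ({c} : Set X) ×ˢ ({d} : Set Y) := by simp
  unfold specLE
  rw [this, closure_prod_eq]
  rfl

theorem dirOpen_upper {X : Type*} (t : TopologicalSpace X) {U : Set X} (hU : DirOpen t U)
    {x y : X} (h : specLE t x y) (hx : x ∈ U) : y ∈ U := by
  obtain ⟨z, hz, hzU⟩ := hU {y}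
    ⟨⟨y, rfl⟩, by rintro a rfl b rfl; exact ⟨_, rfl, specLE_refl' t _, specLE_refl' t _⟩⟩ x hx
    (fun V hV hxV => ⟨y, rfl, (specLE_iff t x y).1 h V hV hxV⟩)
  rw [mem_singleton_iff] at hz
  exact hz ▸ hzU

theorem wayBelow_le {L : Type*} [CompleteLattice L] {a b : L} (h : wayBelow a b) : a ≤ b := by
  obtain ⟨d, hd, h⟩ := h {b} ⟨b, rfl⟩ (by rintro x rfl y rfl; exact ⟨_, rfl, le_rfl, le_rfl⟩)
    (by simp)
  rw [mem_singleton_iff] at hd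
  exact hd ▸ h

theorem wayBelow_mono {L : Type*} [CompleteLattice L] {a b a' b' : L} (h : wayBelow a b)
    (ha : a' ≤ a) (hb : b ≤ b') : wayBelow a' b' := by
  intro D h1 h2 h3
  obtain ⟨d, hd, h⟩ := h D h1 h2 (hb.trans h3)
  exact ⟨d, hd, ha.trans h⟩

theorem wayBelow_interp {L : Type*} [CompleteLattice L] (hL : ContinuousLattice L) {a b : L}
    (h : wayBelow a b) : ∃ c, wayBelow a c ∧ wayBelow c b := by
  obtain ⟨d, ⟨e, hde, heb⟩, had⟩ := h {d | ∃ e, wayBelow d e ∧ wayBelow e b} (by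
      obtain ⟨e, he⟩ := (hL b).1
      obtain ⟨d, hd⟩ := (hL e).1
      exact ⟨d, e, hd, he⟩) (by
      rintro d ⟨e, hde, heb⟩ d' ⟨e', hde', heb'⟩
      obtain ⟨e2, h2, h3, h4⟩ := (hL b).2.1 e heb e' heb'
      obtain ⟨d2, h5, h6, h7⟩ := (hL e2).2.1 d (wayBelow_mono hde le_rfl h3) d'
        (wayBelow_mono hde' le_rfl h4)
      exact ⟨d2, ⟨e2, h5, h2⟩, h6, h7⟩) (by
      conv_lhs => rw [← (hL b).2.2]
      refine sSup_le fun e he => ?_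
      rw [← (hL e).2.2]
      exact sSup_le fun d hd => le_sSup ⟨e, hd, he⟩)
  exact ⟨e, wayBelow_mono hde had le_rfl, heb⟩

theorem isOpen_scott {L : Type*} [Preorder L] {U : Set L} :
    (scottSp L).IsOpen U ↔ ScottOpen U := by
  constructor
  · intro h
    induction h with
    | basic s hs => exact hs
    | univ => exact ⟨isUpperSet_univ, fun D hD _ _ _ _ => by simpa using hD⟩
    | inter s t _ _ hs ht =>
      refine ⟨hs.1.inter ht.1, fun D h1 h2 x hx hxs => ?_⟩
      obtain ⟨d, hd, hds⟩ := hs.2 D h1 h2 x hx hxs.1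
      obtain ⟨e, he, het⟩ := ht.2 D h1 h2 x hx hxs.2
      obtain ⟨c, hc, h3, h4⟩ := h2 d hd e he
      exact ⟨c, hc, hs.1 h3 hds, ht.1 h4 het⟩
    | sUnion S _ ih =>
      refine ⟨isUpperSet_sUnion fun s hs => (ih s hs).1, fun D h1 h2 x hx hxs => ?_⟩
      obtain ⟨s, hs, hxs⟩ := hxs
      obtain ⟨d, hd, hds⟩ := (ih s hs).2 D h1 h2 x hx hxs
      exact ⟨d, hd, s, hs, hds⟩
  · exact fun h => .basic _ h

theorem isOpen_compl_Iic {L : Type*} [Preorder L] (a : L) :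
    (scottSp L).IsOpen (Set.Iic a)ᶜ := by
  rw [isOpen_scott]
  refine ⟨(isLowerSet_Iic a).compl, fun D h1 h2 x hx hxa => ?_⟩
  by_contra hne
  refine hxa (hx.2 fun d hd => ?_)
  by_contra hda
  exact hne ⟨d, hd, hda⟩

theorem specLE_scott {L : Type*} [Preorder L] (a b : L) : specLE (scottSp L) a b ↔ a ≤ b := by
  rw [specLE_iff]
  constructor
  · intro h
    by_contra hab
    exact h _ (isOpen_compl_Iic b) hab (le_refl b)
  · intro h U hU ha
    exact (isOpen_scott.1 hU).1 h ha

theorem dirSpace_scott (L : Type*) [Preorder L] : DirSpace (scottSp L) := by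
  intro U hU
  rw [isOpen_scott]
  refine ⟨fun a b hab ha => dirOpen_upper _ hU ((specLE_scott a b).2 hab) ha, ?_⟩
  intro D h1 h2 s hs hsU
  refine hU D ⟨h1, fun a ha b hb => ?_⟩ s hsU ?_
  · obtain ⟨c, hc, h3, h4⟩ := h2 a ha b hb
    exact ⟨c, hc, (specLE_scott _ _).2 h3, (specLE_scott _ _).2 h4⟩
  · intro V hV hsV
    exact (isOpen_scott.1 hV).2 D h1 h2 s hs hsV

theorem t0_scott (L : Type*) [PartialOrder L] : @T0Space L (scottSp L) := by
  letI := scottSp L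
  refine ⟨fun a b hab => ?_⟩
  have h := inseparable_iff_forall_isOpen.1 hab
  exact le_antisymm ((specLE_scott a b).1 ((specLE_iff _ _ _).2 fun U hU => (h U hU).1))
    ((specLE_scott b a).1 ((specLE_iff _ _ _).2 fun U hU => (h U hU).2))

theorem one_two {X Y : Type*} [t : TopologicalSpace X] [s : TopologicalSpace Y]
    (hX : DirSpace t) (hc : ContinuousLattice (Opens X)) (hY : DirSpace s) :
    DirSpace (@instTopologicalSpaceProd X Y t s) := by
  intro W hW
  have hsec : ∀ y : Y, IsOpen {x : X | (x, y) ∈ W} := by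
    intro y
    refine hX _ fun D hD x hx hDx => ?_
    obtain ⟨p, ⟨d, hd, rfl⟩, hp⟩ := hW ((fun d => (d, y)) '' D) ⟨hD.1.image _, by
      rintro _ ⟨a, ha, rfl⟩ _ ⟨b, hb, rfl⟩
      obtain ⟨c, hc, h3, h4⟩ := hD.2 a ha b hb
      exact ⟨_, ⟨c, hc, rfl⟩, (specLE_prod _ _ _ _).2 ⟨h3, specLE_refl' _ _⟩,
        (specLE_prod _ _ _ _).2 ⟨h4, specLE_refl' _ _⟩⟩⟩ (x, y) hx (by
      intro V hV hxV
      have hV' : IsOpen V := hV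
      obtain ⟨d, hd, hdV⟩ := hDx ((fun d => (d, y)) ⁻¹' V)
        (hV'.preimage (by fun_prop)) hxV
      exact ⟨_, ⟨d, hd, rfl⟩, hdV⟩)
    exact ⟨d, hd, hp⟩
  let F : Y → Opens X := fun y => ⟨_, hsec y⟩
  have hV : ∀ U : Opens X, IsOpen {y | wayBelow U (F y)} := by
    intro U
    refine hY _ fun D hD y hy hDy => ?_
    obtain ⟨U', h1, h2⟩ := wayBelow_interp hc hy
    obtain ⟨_, ⟨d, hd, rfl⟩, h3⟩ := h2 (F '' D) (hD.1.image _) (by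
      rintro _ ⟨a, ha, rfl⟩ _ ⟨b, hb, rfl⟩
      obtain ⟨c, hc, h3, h4⟩ := hD.2 a ha b hb
      refine ⟨_, ⟨c, hc, rfl⟩, ?_, ?_⟩
      · intro x hx
        exact dirOpen_upper _ hW ((specLE_prod _ _ (x, a) (x, c)).2 ⟨specLE_refl' _ _, h3⟩) hx
      · intro x hx
        exact dirOpen_upper _ hW ((specLE_prod _ _ (x, b) (x, c)).2 ⟨specLE_refl' _ _, h4⟩) hx)
      (by
      intro x hx
      obtain ⟨p, ⟨d, hd, rfl⟩, hp⟩ := hW ((fun d => (x, d)) '' D) ⟨hD.1.image _, by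
        rintro _ ⟨a, ha, rfl⟩ _ ⟨b, hb, rfl⟩
        obtain ⟨c, hc, h3, h4⟩ := hD.2 a ha b hb
        exact ⟨_, ⟨c, hc, rfl⟩, (specLE_prod _ _ _ _).2 ⟨specLE_refl' _ _, h3⟩,
          (specLE_prod _ _ _ _).2 ⟨specLE_refl' _ _, h4⟩⟩⟩ (x, y) hx (by
        intro V hV hxV
        have hV' : IsOpen V := hV
        obtain ⟨d, hd, hdV⟩ := hDy ((fun d => (x, d)) ⁻¹' V)
          (hV'.preimage (by fun_prop)) hxV
        exact ⟨_, ⟨d, hd, rfl⟩, hdV⟩)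
      exact Opens.mem_sSup.2 ⟨F d, ⟨d, hd, rfl⟩, hp⟩)
    exact ⟨d, hd, wayBelow_mono h1 le_rfl h3⟩
  change IsOpen W
  rw [isOpen_prod_iff]
  intro x y hxy
  have hx : x ∈ sSup {a : Opens X | wayBelow a (F y)} := by
    rw [(hc (F y)).2.2]; exact hxy
  rw [Opens.mem_sSup] at hx
  obtain ⟨U, hU, hxU⟩ := hx
  refine ⟨U, _, U.isOpen, hV U, hxU, hU, ?_⟩
  rintro ⟨a, b⟩ ⟨ha, hb⟩
  exact wayBelow_le hb ha

theorem dirSpace_swap {X Y : Type*} [t : TopologicalSpace X] [s : TopologicalSpace Y]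
    (h : DirSpace (@instTopologicalSpaceProd X Y t s)) :
    DirSpace (@instTopologicalSpaceProd Y X s t) := by
  intro W hW
  have h1 : IsOpen (Prod.swap ⁻¹' W : Set (X × Y)) := by
    refine h _ fun D hD x hx hDx => ?_
    obtain ⟨_, ⟨d, hd, rfl⟩, hp⟩ := hW (Prod.swap '' D) ⟨hD.1.image _, by
      rintro _ ⟨a, ha, rfl⟩ _ ⟨b, hb, rfl⟩
      obtain ⟨c, hc, h3, h4⟩ := hD.2 a ha b hb
      rw [specLE_prod] at h3 h4
      exact ⟨_, ⟨c, hc, rfl⟩, (specLE_prod _ _ _ _).2 h3.symm,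
        (specLE_prod _ _ _ _).2 h4.symm⟩⟩ x.swap hx (by
      intro V hV hxV
      have hV' : IsOpen V := hV
      obtain ⟨d, hd, hdV⟩ := hDx (Prod.swap ⁻¹' V) (hV'.preimage continuous_swap) hxV
      exact ⟨_, ⟨d, hd, rfl⟩, hdV⟩)
    exact ⟨d, hd, hp⟩
  have h2 := h1.preimage (continuous_swap (X := Y) (Y := X))
  exact h2

theorem three_one {X : Type*} [t : TopologicalSpace X]
    (h : DirSpace (@instTopologicalSpaceProd (Opens X) X (scottSp (Opens X)) t)) :
    ContinuousLattice (Opens X) := by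
  letI := scottSp (Opens X)
  have hE : IsOpen {p : Opens X × X | p.2 ∈ p.1} := by
    refine h _ ?_
    rintro D hD ⟨U, x⟩ hx hDx
    have hUle : U ≤ sSup (Prod.fst '' D) := by
      by_contra hne
      obtain ⟨d, hd, hd'⟩ := hDx (Prod.fst ⁻¹' (Set.Iic (sSup (Prod.fst '' D)))ᶜ)
        (IsOpen.preimage continuous_fst (isOpen_compl_Iic (sSup (Prod.fst '' D)))) hne
      exact hd' (le_sSup (mem_image_of_mem Prod.fst hd) : d.1 ≤ sSup (Prod.fst '' D))
    have hxs := hUle hx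
    rw [Opens.mem_sSup] at hxs
    obtain ⟨_, ⟨d, hd, rfl⟩, hxd⟩ := hxs
    obtain ⟨e, he, hed⟩ := hDx (Prod.snd ⁻¹' (d.1 : Set X))
      (IsOpen.preimage continuous_snd d.1.isOpen) hxd
    obtain ⟨c, hc, h3, h4⟩ := hD.2 d hd e he
    rw [specLE_prod] at h3 h4
    exact ⟨c, hc, (specLE_scott _ _).1 h3.1 ((specLE_iff _ _ _).1 h4.2 _ d.1.isOpen hed)⟩
  intro U
  refine ⟨⟨⊥, fun D hD _ _ => ?_⟩, ?_, ?_⟩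
  · obtain ⟨d, hd⟩ := hD
    exact ⟨d, hd, bot_le⟩
  · intro a ha b hb
    refine ⟨a ⊔ b, fun D h1 h2 h3 => ?_, le_sup_left, le_sup_right⟩
    obtain ⟨d, hd, had⟩ := ha D h1 h2 h3
    obtain ⟨e, he, hbe⟩ := hb D h1 h2 h3
    obtain ⟨c, hc, h4, h5⟩ := h2 d hd e he
    exact ⟨c, hc, sup_le (had.trans h4) (hbe.trans h5)⟩
  · refine le_antisymm (sSup_le fun a ha => wayBelow_le ha) fun x hx => ?_
    obtain ⟨A, V, hA, hV, hUA, hxV, hAV⟩ := isOpen_prod_iff.1 hE U x hx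
    rw [Opens.mem_sSup]
    refine ⟨⟨V, hV⟩, fun D h1 h2 h3 => ?_, hxV⟩
    have hA' := isOpen_scott.1 hA
    obtain ⟨d, hd, hdA⟩ := hA'.2 D h1 h2 _ (isLUB_sSup D) (hA'.1 h3 hUA)
    exact ⟨d, hd, fun y hy => hAV (⟨hdA, hy⟩ : (d, y) ∈ A ×ˢ V)⟩

theorem statement14 {X : Type u} [t : TopologicalSpace X] [T0Space X] (hX : DirSpace t) :
    (ContinuousLattice (Opens X) ↔
      ∀ (Y : Type u) (tY : TopologicalSpace Y), @T0Space Y tY → DirSpace tY →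
        DirSpace (@instTopologicalSpaceProd X Y t tY)) ∧
    (ContinuousLattice (Opens X) ↔
      DirSpace (@instTopologicalSpaceProd (Opens X) X (scottSp (Opens X)) t)) := by
  have h12 : ContinuousLattice (Opens X) →
      ∀ (Y : Type u) (tY : TopologicalSpace Y), @T0Space Y tY → DirSpace tY →
        DirSpace (@instTopologicalSpaceProd X Y t tY) :=
    fun hc Y tY _ hY => one_two hX hc hY
  have h23 : (∀ (Y : Type u) (tY : TopologicalSpace Y), @T0Space Y tY → DirSpace tY →
        DirSpace (@instTopologicalSpaceProd X Y t tY)) →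
      DirSpace (@instTopologicalSpaceProd (Opens X) X (scottSp (Opens X)) t) := fun h =>
    @dirSpace_swap X (Opens X) t (scottSp (Opens X))
      (h (Opens X) (scottSp (Opens X)) (t0_scott _) (dirSpace_scott _))
  exact ⟨⟨h12, fun h => three_one (h23 h)⟩, ⟨fun h => h23 (h12 h), three_one⟩⟩
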